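/- arXiv:1605.00001 — 2 statements merged into one kernel-verified Lean document; each statement's English description precedes it below -/
import Mathlib

section
/- Main result (Eq. (3.17), K ≥ 1 case): for integers Z ≥ 1, X, and K with 1 ≤ K ≤ N, the joint probability that the walk is at X after N steps and has visited Z exactly K times satisfies P_N(X, K | Z) = (1/2) [ p_{N−K}(|X−Z| + Z + K − 2) − p_{N−K}(|X−Z| + Z + K) ]. -/
open Finset Filter Real

noncomputable section

/-- A walk path of length `N` is `ε : Fin N → Bool`; `true` means a `+1` step,
`false` a `-1` step. `S ε n` is the partial sum `S_n` of the first `n` steps. -/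
def S {N : ℕ} (ε : Fin N → Bool) (n : ℕ) : ℤ :=
  ∑ i ∈ Finset.univ.filter (fun i : Fin N => (i : ℕ) < n), (if ε i then (1 : ℤ) else -1)

/-- `p N X`: probability the simple symmetric random walk is at `X` after `N` steps. -/
def p (N : ℕ) (X : ℤ) : ℝ :=
  ((Finset.univ.filter (fun ε : Fin N → Bool => S ε N = X)).card : ℝ) / 2 ^ N

/-- Number of visits of the path `ε` to site `Z` at times `n ∈ {1, …, N}`. -/
def visits (N : ℕ) (Z : ℤ) (ε : Fin N → Bool) : ℕ :=
  ((Finset.Icc 1 N).filter (fun n => S ε n = Z)).card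

/-- `P N X K Z`: joint probability that after `N` steps the walk is at `X`
and has visited `Z` exactly `K` times. -/
def P (N : ℕ) (X : ℤ) (K : ℕ) (Z : ℤ) : ℝ :=
  ((Finset.univ.filter
      (fun ε : Fin N → Bool => S ε N = X ∧ visits N Z ε = K)).card : ℝ) / 2 ^ N

/-- `Pmarg N K Z`: probability of exactly `K` visits to `Z` in the first `N` steps. -/
def Pmarg (N : ℕ) (K : ℕ) (Z : ℤ) : ℝ :=
  ((Finset.univ.filter (fun ε : Fin N → Bool => visits N Z ε = K)).card : ℝ) / 2 ^ N

theorem S_snoc_of_le {N : ℕ} (ε : Fin N → Bool) (b : Bool) {n : ℕ} (hn : n ≤ N) :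
    S (Fin.snoc ε b : Fin (N + 1) → Bool) n = S ε n := by
  simp [S, Finset.sum_filter, Fin.sum_univ_castSucc, hn]

theorem S_snoc_last {N : ℕ} (ε : Fin N → Bool) (b : Bool) :
    S (Fin.snoc ε b : Fin (N + 1) → Bool) (N + 1) = S ε N + if b then 1 else -1 := by
  simp [S, Finset.sum_filter, Fin.sum_univ_castSucc]

theorem visits_snoc {N : ℕ} (Z : ℤ) (ε : Fin N → Bool) (b : Bool) :
    visits (N + 1) Z (Fin.snoc ε b) =
      visits N Z ε + if S ε N + (if b then 1 else -1) = Z then 1 else 0 := by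
  unfold visits
  rw [Finset.card_filter, Finset.card_filter, Finset.sum_Icc_succ_top (by omega), S_snoc_last]
  congr 1
  refine Finset.sum_congr rfl fun n hn => ?_
  rw [S_snoc_of_le ε b (Finset.mem_Icc.mp hn).2]

theorem visits_le (N : ℕ) (Z : ℤ) (ε : Fin N → Bool) : visits N Z ε ≤ N := by
  simpa [visits] using Finset.card_filter_le (Finset.Icc 1 N) fun n => S ε n = Z

/-- Splitting the count of paths of length `N + 1` according to the last step. -/
theorem card_filter_snoc {N : ℕ} (Q : (Fin (N + 1) → Bool) → Prop) [DecidablePred Q] :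
    (Finset.univ.filter Q).card =
      (Finset.univ.filter fun ε : Fin N → Bool => Q (Fin.snoc ε true)).card +
        (Finset.univ.filter fun ε : Fin N → Bool => Q (Fin.snoc ε false)).card := by
  simp only [Finset.card_filter]
  rw [← (Fin.snocEquiv fun _ : Fin (N + 1) => Bool).sum_comp, Fintype.sum_prod_type,
    Fintype.sum_bool]
  rfl

theorem p_succ (N : ℕ) (X : ℤ) : p (N + 1) X = (p N (X - 1) + p N (X + 1)) / 2 := by
  have h₁ (ε : Fin N → Bool) : S ε N + 1 = X ↔ S ε N = X - 1 := by omega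
  have h₂ (ε : Fin N → Bool) : S ε N + -1 = X ↔ S ε N = X + 1 := by omega
  simp only [p, card_filter_snoc, S_snoc_last, if_true, Bool.false_eq_true, if_false, h₁, h₂]
  push_cast
  ring

theorem P_succ_of_ne (N : ℕ) {X Z : ℤ} (K : ℕ) (h : X ≠ Z) :
    P (N + 1) X K Z = (P N (X - 1) K Z + P N (X + 1) K Z) / 2 := by
  have h₁ (ε : Fin N → Bool) :
      (S ε N + 1 = X ∧ visits N Z ε + (if S ε N + 1 = Z then 1 else 0) = K) ↔
        (S ε N = X - 1 ∧ visits N Z ε = K) := by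
    split_ifs <;> omega
  have h₂ (ε : Fin N → Bool) :
      (S ε N + -1 = X ∧ visits N Z ε + (if S ε N + -1 = Z then 1 else 0) = K) ↔
        (S ε N = X + 1 ∧ visits N Z ε = K) := by
    split_ifs <;> omega
  simp only [P, card_filter_snoc, S_snoc_last, visits_snoc, if_true, Bool.false_eq_true,
    if_false, h₁, h₂]
  push_cast
  ring

theorem P_succ_self (N : ℕ) (Z : ℤ) (K : ℕ) :
    P (N + 1) Z (K + 1) Z = (P N (Z - 1) K Z + P N (Z + 1) K Z) / 2 := by
  have h₁ (ε : Fin N → Bool) :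
      (S ε N + 1 = Z ∧ visits N Z ε + (if S ε N + 1 = Z then 1 else 0) = K + 1) ↔
        (S ε N = Z - 1 ∧ visits N Z ε = K) := by
    split_ifs <;> omega
  have h₂ (ε : Fin N → Bool) :
      (S ε N + -1 = Z ∧ visits N Z ε + (if S ε N + -1 = Z then 1 else 0) = K + 1) ↔
        (S ε N = Z + 1 ∧ visits N Z ε = K) := by
    split_ifs <;> omega
  simp only [P, card_filter_snoc, S_snoc_last, visits_snoc, if_true, Bool.false_eq_true,
    if_false, h₁, h₂]
  push_cast
  ring

theorem P_succ_self_zero (N : ℕ) (Z : ℤ) : P (N + 1) Z 0 Z = 0 := by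
  have h (ε : Fin N → Bool) (s : ℤ) :
      ¬ (S ε N + s = Z ∧ visits N Z ε + (if S ε N + s = Z then 1 else 0) = 0) := by
    rintro ⟨h₁, h₂⟩
    simp [h₁] at h₂
  simp only [P, card_filter_snoc, S_snoc_last, visits_snoc, h, Finset.filter_false,
    Finset.card_empty]
  simp

theorem P_eq_zero_of_lt {N K : ℕ} (h : N < K) (X Z : ℤ) : P N X K Z = 0 := by
  have h' (ε : Fin N → Bool) : visits N Z ε ≠ K := ((visits_le N Z ε).trans_lt h).ne
  simp [P, h']

theorem p_zero (X : ℤ) : p 0 X = if X = 0 then 1 else 0 := by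
  by_cases h : X = 0 <;> simp [p, S, h, Ne.symm]

theorem P_zero_zero (X Z : ℤ) : P 0 X 0 Z = if X = 0 then 1 else 0 := by
  by_cases h : X = 0 <;> simp [P, S, visits, h, Ne.symm]

theorem P_zero_visits_of_ge {Z : ℤ} (hZ : 1 ≤ Z) (N : ℕ) {X : ℤ} (hX : Z ≤ X) :
    P N X 0 Z = 0 := by
  induction N generalizing X with
  | zero => rw [P_zero_zero, if_neg (by omega)]
  | succ N ih =>
    obtain rfl | h := eq_or_ne X Z
    · exact P_succ_self_zero N X
    · rw [P_succ_of_ne N 0 h, ih (by omega), ih (by omega)]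
      simp

/-- The reflection principle: paths from `0` to `X ≤ Z` avoiding `Z`. -/
theorem P_zero_visits_of_le {Z : ℤ} (hZ : 1 ≤ Z) (N : ℕ) {X : ℤ} (hX : X ≤ Z) :
    P N X 0 Z = p N X - p N (2 * Z - X) := by
  induction N generalizing X with
  | zero => rw [P_zero_zero, p_zero, p_zero, if_neg (by omega : ¬ 2 * Z - X = 0), sub_zero]
  | succ N ih =>
    obtain rfl | h := eq_or_ne X Z
    · rw [P_succ_self_zero, show 2 * X - X = X by ring, sub_self]
    · rw [P_succ_of_ne N 0 h, ih (by omega), ih (by omega), p_succ, p_succ,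
        show 2 * Z - (X - 1) = 2 * Z - X + 1 by ring,
        show 2 * Z - (X + 1) = 2 * Z - X - 1 by ring]
      ring

/-- Eq. (3.17), `K ≥ 1` case:
`P_N(X, K | Z) = ½ (p_{N−K}(|X−Z|+Z+K−2) − p_{N−K}(|X−Z|+Z+K))`. -/
theorem joint_distribution (N : ℕ) (Z X : ℤ) (K : ℕ) (hZ : 1 ≤ Z)
    (hK1 : 1 ≤ K) (hKN : K ≤ N) :
    P N X K Z =
      (1 / 2) * (p (N - K) (|X - Z| + Z + (K : ℤ) - 2)
        - p (N - K) (|X - Z| + Z + (K : ℤ))) := by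
  induction N generalizing X K with
  | zero => omega
  | succ N ih =>
    obtain ⟨K, rfl⟩ := Nat.exists_eq_add_of_le' hK1
    obtain rfl | h := eq_or_ne X Z
    · rw [P_succ_self, Nat.add_sub_add_right]
      obtain rfl | hK := Nat.eq_zero_or_pos K
      · rw [P_zero_visits_of_le hZ N (by omega), P_zero_visits_of_ge hZ N (by omega)]
        simp only [sub_self, abs_zero, Nat.sub_zero]
        ring_nf
      · rw [ih _ K hK (by omega), ih _ K hK (by omega)]
        simp only [sub_self, abs_zero, sub_sub_cancel_left, add_sub_cancel_left, abs_neg, abs_one]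
        push_cast
        ring_nf
    · rw [P_succ_of_ne N _ h]
      obtain hK | hK := Nat.lt_or_ge N (K + 1)
      · have hd : 0 < |X - Z| := abs_pos.mpr (sub_ne_zero.mpr h)
        rw [P_eq_zero_of_lt hK, P_eq_zero_of_lt hK, show N + 1 - (K + 1) = 0 by omega, p_zero,
          p_zero, if_neg (by push_cast; omega), if_neg (by push_cast; omega)]
        simp
      · rw [ih _ _ hK1 hK, ih _ _ hK1 hK, show N + 1 - (K + 1) = N - (K + 1) + 1 by omega,
          p_succ, p_succ]
        obtain h | h := lt_or_gt_of_ne h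
        · rw [abs_of_neg (by omega : X - Z < 0), abs_of_neg (by omega : X - 1 - Z < 0),
            abs_of_nonpos (by omega : X + 1 - Z ≤ 0)]
          ring_nf
        · rw [abs_of_pos (by omega : 0 < X - Z), abs_of_nonneg (by omega : 0 ≤ X - 1 - Z),
            abs_of_pos (by omega : 0 < X + 1 - Z)]
          ring_nf
end
end

section
/- K-marginal in binomial form (Eq. (4.6), K ≥ 1 case): for integers Z ≥ 1 and K with 1 ≤ K ≤ N, the probability 𝒫_N(K|Z) of exactly K visits to Z in the first N steps equals 2^{−(N−K)} · binom(N−K, (N+Z−1)/2) if N − Z is odd, and equals 2^{−(N+1−K)} · binom(N+1−K, (N+Z)/2) if N − Z is even (with binom(n,k) = 0 when k > n). -/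
open Finset Filter Real

noncomputable section

lemma S_cons_succ {N : ℕ} (b : Bool) (ε : Fin N → Bool) (n : ℕ) :
    S (Fin.cons b ε : Fin (N + 1) → Bool) (n + 1) = (if b then 1 else -1) + S ε n := by
  simp [S, Finset.sum_filter, Fin.sum_univ_succ]

lemma S_zero {N : ℕ} (ε : Fin N → Bool) : S ε 0 = 0 := by
  simp [S]

/-- Number of times `n ∈ {0, …, N}` at which the path `ε` is at `Z`. -/
def occupation (N : ℕ) (Z : ℤ) (ε : Fin N → Bool) : ℕ :=
  ∑ n ∈ range (N + 1), if S ε n = Z then 1 else 0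

lemma visits_eq_occupation {N : ℕ} {Z : ℤ} (hZ : Z ≠ 0) (ε : Fin N → Bool) :
    visits N Z ε = occupation N Z ε := by
  rw [occupation, Finset.sum_range_succ', S_zero, if_neg hZ.symm, add_zero, visits,
    Finset.card_filter, Finset.range_eq_Ico,
    Finset.sum_Ico_add' (fun n => if S ε n = Z then 1 else 0)]
  rfl

lemma occupation_cons {N : ℕ} (Z : ℤ) (b : Bool) (ε : Fin N → Bool) :
    occupation (N + 1) Z (Fin.cons b ε) =
      occupation N (Z - if b then 1 else -1) ε + if Z = 0 then 1 else 0 := by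
  rw [occupation, Finset.sum_range_succ', S_zero, occupation]
  simp only [S_cons_succ, eq_sub_iff_add_eq', eq_comm (a := (0 : ℤ))]

/-- Number of paths of length `N` with exactly `K` visits to `Z` at times `{0, …, N}`. -/
def occupationCount (N : ℕ) (Z : ℤ) (K : ℕ) : ℕ :=
  (univ.filter fun ε : Fin N → Bool => occupation N Z ε = K).card

lemma occupationCount_zero_left (Z : ℤ) (K : ℕ) :
    occupationCount 0 Z K = if (if Z = 0 then 1 else 0) = K then 1 else 0 := by
  simp only [occupationCount, occupation, zero_add, Finset.sum_range_one, S_zero,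
    eq_comm (a := (0 : ℤ)), Finset.card_filter]
  simp

lemma occupationCount_succ (N : ℕ) (Z : ℤ) (K : ℕ) :
    occupationCount (N + 1) Z K =
      (univ.filter fun ε : Fin N → Bool =>
        occupation N (Z - 1) ε + (if Z = 0 then 1 else 0) = K).card +
      (univ.filter fun ε : Fin N → Bool =>
        occupation N (Z + 1) ε + (if Z = 0 then 1 else 0) = K).card := by
  simp only [occupationCount, Finset.card_filter]
  rw [← (Fin.consEquiv fun _ : Fin (N + 1) => Bool).sum_comp, Fintype.sum_prod_type]
  simp [Fin.consEquiv, occupation_cons]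

lemma occupationCount_succ_of_ne_zero (N : ℕ) {Z : ℤ} (hZ : Z ≠ 0) (K : ℕ) :
    occupationCount (N + 1) Z K =
      occupationCount N (Z - 1) K + occupationCount N (Z + 1) K := by
  rw [occupationCount_succ]
  simp [hZ, occupationCount]

lemma occupationCount_succ_zero_succ (N K : ℕ) :
    occupationCount (N + 1) 0 (K + 1) =
      occupationCount N (-1) K + occupationCount N 1 K := by
  rw [occupationCount_succ]
  simp [occupationCount]

lemma occupationCount_zero_zero (N : ℕ) : occupationCount N 0 0 = 0 := by
  cases N with
  | zero => simp [occupationCount_zero_left]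
  | succ N => simp [occupationCount_succ]

lemma occupationCount_neg (N : ℕ) (Z : ℤ) (K : ℕ) :
    occupationCount N (-Z) K = occupationCount N Z K := by
  induction N generalizing Z with
  | zero => simp [occupationCount_zero_left]
  | succ N ih =>
    rcases eq_or_ne Z 0 with rfl | hZ
    · simp
    · rw [occupationCount_succ_of_ne_zero N hZ,
        occupationCount_succ_of_ne_zero N (neg_ne_zero.mpr hZ), ← ih (Z - 1), ← ih (Z + 1),
        add_comm]
      ring_nf

lemma occupationCount_succ_zero_succ_eq_two_mul (N K : ℕ) :
    occupationCount (N + 1) 0 (K + 1) = 2 * occupationCount N 1 K := by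
  rw [occupationCount_succ_zero_succ, occupationCount_neg, two_mul]

lemma occupationCount_succ_natCast_succ (N z K : ℕ) :
    occupationCount (N + 1) (z + 1 : ℕ) K =
      occupationCount N z K + occupationCount N (z + 2 : ℕ) K := by
  rw [occupationCount_succ_of_ne_zero N (by positivity)]
  push_cast
  ring_nf

lemma occupationCount_no_visit_succ (N z : ℕ) :
    occupationCount N (z + 1 : ℕ) 0 =
      occupationCount N z 0 + N.choose ((N + z + 1) / 2) := by
  induction N generalizing z with
  | zero =>
    rcases z with _ | z
    · simp [occupationCount_zero_left]
    · rw [Nat.choose_eq_zero_of_lt (by omega)]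
      simp only [occupationCount_zero_left]
      norm_cast
  | succ N ih =>
    rcases z with _ | z
    · have h1 := ih 0
      have h2 := ih 1
      simp only [Nat.cast_zero, occupationCount_zero_zero, zero_add] at h1
      rw [occupationCount_succ_natCast_succ, Nat.cast_zero, occupationCount_zero_zero,
        occupationCount_zero_zero, h2, h1, show (N + 1 + 1) / 2 = N / 2 + 1 by omega,
        Nat.choose_succ_succ,
        Nat.choose_symm_of_eq_add (show N = (N + 0 + 1) / 2 + N / 2 by omega)]
    · rw [occupationCount_succ_natCast_succ, occupationCount_succ_natCast_succ, ih z, ih (z + 2),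
        show (N + 1 + (z + 1) + 1) / 2 = (N + z + 1) / 2 + 1 by omega, Nat.choose_succ_succ,
        show (N + (z + 2) + 1) / 2 = (N + z + 1) / 2 + 1 by omega]
      ring

lemma occupationCount_one_zero (N : ℕ) :
    occupationCount N 1 0 = N.choose ((N + 1) / 2) := by
  simpa [occupationCount_zero_zero] using occupationCount_no_visit_succ N 0

lemma occupationCount_of_even {N z m : ℕ} (h : N + z = 2 * m) (K : ℕ) :
    occupationCount N z (K + 1) = if K ≤ N then 2 ^ K * (N - K).choose m else 0 := by
  induction N generalizing z m K with
  | zero =>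
    rcases m with _ | m
    · obtain rfl : z = 0 := by omega
      rcases K with _ | K <;> simp [occupationCount_zero_left]
    · have hz : z ≠ 0 := by omega
      simp [occupationCount_zero_left, hz]
  | succ N ih =>
    rcases z with _ | z
    · rw [Nat.cast_zero, occupationCount_succ_zero_succ_eq_two_mul]
      rcases K with _ | K
      · obtain ⟨j, rfl⟩ : ∃ j, m = j + 1 := ⟨m - 1, by omega⟩
        obtain rfl : N = 2 * j + 1 := by omega
        rw [occupationCount_one_zero, show (2 * j + 1 + 1) / 2 = j + 1 by omega]
        simp only [zero_le, if_true, pow_zero, one_mul, Nat.sub_zero]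
        rw [Nat.choose_succ_succ (2 * j + 1) j,
          Nat.choose_symm_of_eq_add (show 2 * j + 1 = j + (j + 1) by omega)]
        ring
      · have := ih (z := 1) (by omega) K
        rw [Nat.cast_one] at this
        rw [this]
        simp only [add_le_add_iff_right, Nat.add_sub_add_right]
        split_ifs <;> ring
    · obtain ⟨j, rfl⟩ : ∃ j, m = j + 1 := ⟨m - 1, by omega⟩
      rw [occupationCount_succ_natCast_succ, ih (m := j) (by omega), ih (m := j + 1) (by omega)]
      rcases lt_trichotomy K (N + 1) with hK | rfl | hK
      · rw [if_pos (by omega), if_pos (by omega), if_pos (by omega), Nat.succ_sub (by omega),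
          Nat.choose_succ_succ]
        ring
      · simp
      · rw [if_neg (by omega), if_neg (by omega), if_neg (by omega)]

lemma occupationCount_of_odd {N z m : ℕ} (h : N + z = 2 * m + 1) (K : ℕ) :
    occupationCount N z (K + 1) =
      if K + 1 ≤ N then 2 ^ (K + 1) * (N - (K + 1)).choose m else 0 := by
  induction N generalizing z m K with
  | zero =>
    have hz : z ≠ 0 := by omega
    simp [occupationCount_zero_left, hz]
  | succ N ih =>
    rcases z with _ | z
    · rw [Nat.cast_zero, occupationCount_succ_zero_succ_eq_two_mul]
      rcases K with _ | K
      · rw [occupationCount_one_zero, show (N + 1) / 2 = m by omega]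
        simp
      · have := ih (z := 1) (by omega) K
        rw [Nat.cast_one] at this
        rw [this]
        simp only [add_le_add_iff_right, Nat.add_sub_add_right]
        split_ifs <;> ring
    · rcases m with _ | j
      · omega
      rw [occupationCount_succ_natCast_succ, ih (m := j) (by omega), ih (m := j + 1) (by omega)]
      rcases lt_trichotomy K N with hK | rfl | hK
      · rw [if_pos (by omega), if_pos (by omega), if_pos (by omega), Nat.succ_sub (by omega),
          Nat.choose_succ_succ]
        ring
      · simp
      · rw [if_neg (by omega), if_neg (by omega), if_neg (by omega)]

/-- Eq. (4.6), `K ≥ 1` case: the visit-number marginal in binomial form. -/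
theorem K_marginal_binomial (N : ℕ) (Z : ℤ) (K : ℕ) (hZ : 1 ≤ Z)
    (hK1 : 1 ≤ K) (hKN : K ≤ N) :
    Pmarg N K Z =
      if Odd ((N : ℤ) - Z) then
        ((N - K).choose (((N : ℤ) + Z - 1) / 2).toNat : ℝ) / 2 ^ (N - K)
      else
        ((N + 1 - K).choose (((N : ℤ) + Z) / 2).toNat : ℝ) / 2 ^ (N + 1 - K) := by
  lift Z to ℕ using by omega
  obtain ⟨k, rfl⟩ : ∃ k, K = k + 1 := ⟨K - 1, by omega⟩
  have hcount : Pmarg N (k + 1) Z = (occupationCount N Z (k + 1) : ℝ) / 2 ^ N := by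
    simp only [Pmarg, occupationCount, visits_eq_occupation (show (Z : ℤ) ≠ 0 by omega)]
  rw [hcount]
  split_ifs with hpar
  · obtain ⟨m, hm⟩ : ∃ m, N + Z = 2 * m + 1 := ⟨(N + Z) / 2, by
      rw [Int.odd_iff] at hpar
      omega⟩
    rw [occupationCount_of_odd hm, if_pos hKN, show (((N : ℤ) + Z - 1) / 2).toNat = m by omega,
      div_eq_div_iff (by positivity) (by positivity)]
    push_cast
    rw [mul_right_comm, ← pow_add, Nat.add_sub_cancel' hKN, mul_comm]
  · obtain ⟨m, hm⟩ : ∃ m, N + Z = 2 * m := ⟨(N + Z) / 2, by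
      rw [Int.odd_iff] at hpar
      omega⟩
    have hkN : k ≤ N := by omega
    rw [occupationCount_of_even hm, if_pos hkN, show (((N : ℤ) + Z) / 2).toNat = m by omega,
      Nat.add_sub_add_right, div_eq_div_iff (by positivity) (by positivity)]
    push_cast
    rw [mul_right_comm, ← pow_add, Nat.add_sub_cancel' hkN, mul_comm]
end
end
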